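/- Let n ≥ 9 and let (θ, k) be a finite arc coloring of the unit circle with n arcs that is proper and cyclic. Then for every pair of distinct colors a, b ∈ Fin 3 there exist pairwise distinct indices i, j, l ∈ Fin n such that the unordered pairs {k (i−1), k i}, {k (j−1), k j}, {k (l−1), k l} (indices cyclic) all equal {a, b}, and the three breakpoints P (θ i), P (θ j), P (θ l) have pairwise Euclidean distances greater than 1. -/

import Mathlib

/-- The point of the unit circle in the Euclidean plane at angle `t`. -/
noncomputable def circlePt (t : ℝ) : EuclideanSpace ℝ (Fin 2) :=
  (EuclideanSpace.equiv (Fin 2) ℝ).symm ![Real.cos t, Real.sin t]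

/-- The right endpoint angle of the `i`-th arc of a finite arc coloring (cyclically, with
`θ n` meaning `θ 0 + 2π`). -/
noncomputable def arcEnd (n : ℕ) (hn : n ≠ 0) (θ : Fin n → ℝ) (i : Fin n) : ℝ :=
  haveI : NeZero n := ⟨hn⟩
  if (i : ℕ) + 1 = n then θ 0 + 2 * Real.pi else θ (i + 1)

/-- A finite arc coloring of the unit circle, given by strictly increasing breakpoint angles
`θ` with `θ (n-1) < θ 0 + 2π` and arc colors `k`, is proper if cyclically adjacent arcs have
different colors, monochromatic points at distance 1 have different colors, and bichromatic
points at distance 1 have different multicolors. -/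
def IsProperArcColoring (n : ℕ) (hn : n ≠ 0) (θ : Fin n → ℝ) (k : Fin n → Fin 3) : Prop :=
  haveI : NeZero n := ⟨hn⟩
  StrictMono θ ∧
  θ ⟨n - 1, Nat.sub_lt (Nat.pos_of_ne_zero hn) one_pos⟩ < θ 0 + 2 * Real.pi ∧
  (∀ i : Fin n, k (i + 1) ≠ k i) ∧
  (∀ i j : Fin n, ∀ s t : ℝ, s ∈ Set.Ioo (θ i) (arcEnd n hn θ i) →
    t ∈ Set.Ioo (θ j) (arcEnd n hn θ j) →
    dist (circlePt s) (circlePt t) = 1 → k i ≠ k j) ∧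
  (∀ i j : Fin n, i ≠ j → dist (circlePt (θ i)) (circlePt (θ j)) = 1 →
    ({k (i - 1), k i} : Set (Fin 3)) ≠ {k (j - 1), k j})

/-- A finite arc coloring is cyclic if no arc is bordered on both sides by arcs of the same
color. -/
def IsCyclicArcColoring (n : ℕ) (hn : n ≠ 0) (k : Fin n → Fin 3) : Prop :=
  haveI : NeZero n := ⟨hn⟩
  ∀ i : Fin n, k (i + 1) ≠ k (i - 1)

theorem aux_dist_sq (s t : ℝ) :
    dist (circlePt s) (circlePt t) ^ 2 = 2 - 2 * Real.cos (s - t) := by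
  rw [EuclideanSpace.dist_eq, Real.sq_sqrt (by positivity)]
  simp only [circlePt, Fin.sum_univ_two, Real.dist_eq, sq_abs, Real.cos_sub]
  have h1 := Real.sin_sq_add_cos_sq s
  have h2 := Real.sin_sq_add_cos_sq t
  simp
  nlinarith

theorem aux_dist_one (s t : ℝ) (h : t - s = Real.pi / 3) :
    dist (circlePt s) (circlePt t) = 1 := by
  have h1 := aux_dist_sq s t
  have h2 : s - t = -(Real.pi / 3) := by linarith
  rw [h2, Real.cos_neg, Real.cos_pi_div_three] at h1
  have h3 : 0 ≤ dist (circlePt s) (circlePt t) := dist_nonneg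
  nlinarith

theorem aux_dist_gt (s t : ℝ) (h : Real.pi / 3 < t - s) (h' : t - s < 2 * Real.pi - Real.pi / 3) :
    1 < dist (circlePt s) (circlePt t) := by
  have h1 := aux_dist_sq s t
  have hpi := Real.pi_pos
  have hc : Real.cos (s - t) < 1 / 2 := by
    rw [← Real.cos_neg, neg_sub]
    by_cases hle : t - s ≤ Real.pi
    · rw [← Real.cos_pi_div_three]
      exact Real.cos_lt_cos_of_nonneg_of_le_pi (by positivity) hle h
    · rw [← Real.cos_two_pi_sub, ← Real.cos_pi_div_three]
      exact Real.cos_lt_cos_of_nonneg_of_le_pi (by positivity) (by linarith) (by linarith)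
  have h3 : 0 ≤ dist (circlePt s) (circlePt t) := dist_nonneg
  nlinarith

theorem aux_periodic (t : ℝ) (m : ℕ) : circlePt (t + 2 * Real.pi * m) = circlePt t := by
  have h : t + 2 * Real.pi * m = t + m * (2 * Real.pi) := by ring
  unfold circlePt
  rw [h, Real.cos_add_nat_mul_two_pi, Real.sin_add_nat_mul_two_pi]

/-- The combinatorial core, for the lifted sequence of breakpoints. -/
theorem aux_core (n d : ℕ) (α : ℝ) (T : ℕ → ℝ) (hT : StrictMono T)
    (hper : ∀ j, T (j + n) = T j + 6 * α) (hd : n < 6 * (d + 1)) (hdn : d + 1 ≤ n)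
    (hAB : ∀ i, T (i + d + 1) ≤ T i + α ∨ T (i + 1) + α ≤ T (i + d)) (i : ℕ) :
    T i + α < T (i + d) := by
  have hB : ∀ i, T (i + 1) + α ≤ T (i + d) := by
    intro i
    by_contra hi
    have hi6 : ∀ m : ℕ, ¬ T (i + m * n + 1) + α ≤ T (i + m * n + d) := by
      intro m
      induction m with
      | zero => simpa using hi
      | succ m ih =>
        intro h
        apply ih
        have e1 := hper (i + m * n + 1)
        have e2 := hper (i + m * n + d)
        have r1 : i + (m + 1) * n + 1 = i + m * n + 1 + n := by ring
        have r2 : i + (m + 1) * n + d = i + m * n + d + n := by ring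
        rw [r1, r2] at h
        linarith
    have hstep : ∀ j, T (j + 1) + α ≤ T (j + d) → T (j + 1 + 1) + α ≤ T (j + 1 + d) := by
      intro j h
      rcases hAB (j + 1) with h1 | h1
      · have := hT (show j + d < j + 1 + d + 1 by omega)
        linarith
      · exact h1
    have hup : ∀ j m, T (j + 1) + α ≤ T (j + d) → T (j + m + 1) + α ≤ T (j + m + d) := by
      intro j m h
      induction m with
      | zero => simpa using h
      | succ m ih => exact hstep (j + m) ih
    have hA : ∀ j, j ≤ 6 * n → T (j + d + 1) ≤ T j + α := by
      intro j hj
      rcases hAB j with h | h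
      · exact h
      · exfalso
        have := hup j (i + 6 * n - j) h
        rw [show j + (i + 6 * n - j) = i + 6 * n by omega] at this
        exact hi6 6 this
    have c0 := hA 0 (by omega)
    have c1 := hA (0 + d + 1) (by omega)
    have c2 := hA (0 + d + 1 + d + 1) (by omega)
    have c3 := hA (0 + d + 1 + d + 1 + d + 1) (by omega)
    have c4 := hA (0 + d + 1 + d + 1 + d + 1 + d + 1) (by omega)
    have c5 := hA (0 + d + 1 + d + 1 + d + 1 + d + 1 + d + 1) (by omega)
    have := hT (show 0 + n < 0 + d + 1 + d + 1 + d + 1 + d + 1 + d + 1 + d + 1 by omega)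
    have := hper 0
    linarith
  have := hB i
  have := hT (Nat.lt_succ_self i)
  simp only [Nat.succ_eq_add_one] at this
  linarith

theorem aux_fin3 : ∀ p q r s : Fin 3, q ≠ p → r ≠ q → s ≠ r → r ≠ p → s ≠ q → s = p := by
  decide

theorem aux_pair (K : ℕ → Fin 3) (h1 : ∀ j, K (j + 1) ≠ K j) (h2 : ∀ j, K (j + 2) ≠ K j)
    (a b : Fin 3) (hab : a ≠ b) : ∃ c, ({K c, K (c + 1)} : Set (Fin 3)) = {a, b} := by
  have key : ∀ p q r s a b : Fin 3, q ≠ p → r ≠ q → r ≠ p → s = p → a ≠ b →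
      (p = a ∧ q = b ∨ p = b ∧ q = a) ∨ (q = a ∧ r = b ∨ q = b ∧ r = a) ∨
      (r = a ∧ s = b ∨ r = b ∧ s = a) := by decide
  have h3 : K 3 = K 0 := aux_fin3 _ _ _ _ (h1 0) (h1 1) (h1 2) (h2 0) (h2 1)
  rcases key _ _ _ _ a b (h1 0) (h1 1) (h2 0) h3 hab with h | h | h
  · refine ⟨0, ?_⟩
    rcases h with ⟨e, f⟩ | ⟨e, f⟩
    · simp only [Nat.reduceAdd] at f ⊢; rw [e, f]
    · simp only [Nat.reduceAdd] at f ⊢; rw [e, f, Set.pair_comm]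
  · refine ⟨1, ?_⟩
    rcases h with ⟨e, f⟩ | ⟨e, f⟩
    · simp only [Nat.reduceAdd] at e f ⊢; rw [e, f]
    · simp only [Nat.reduceAdd] at e f ⊢; rw [e, f, Set.pair_comm]
  · refine ⟨2, ?_⟩
    rcases h with ⟨e, f⟩ | ⟨e, f⟩
    · simp only [Nat.reduceAdd] at e f ⊢; rw [e, f]
    · simp only [Nat.reduceAdd] at e f ⊢; rw [e, f, Set.pair_comm]

/-- In a proper cyclic arc coloring of the unit circle with at least 9 arcs, for every pair of
distinct colors there are three bichromatic breakpoints with that multicolor at pairwise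
distances greater than 1. -/
theorem stmt_12 (n : ℕ) (hn : 9 ≤ n) (θ : Fin n → ℝ) (k : Fin n → Fin 3)
    (hn0 : n ≠ 0)
    (hp : IsProperArcColoring n hn0 θ k) (hcyc : IsCyclicArcColoring n hn0 k)
    (a b : Fin 3) (hab : a ≠ b) :
    haveI : NeZero n := ⟨hn0⟩
    ∃ i j l : Fin n, i ≠ j ∧ i ≠ l ∧ j ≠ l ∧
      ({k (i - 1), k i} : Set (Fin 3)) = {a, b} ∧
      ({k (j - 1), k j} : Set (Fin 3)) = {a, b} ∧
      ({k (l - 1), k l} : Set (Fin 3)) = {a, b} ∧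
      1 < dist (circlePt (θ i)) (circlePt (θ j)) ∧
      1 < dist (circlePt (θ i)) (circlePt (θ l)) ∧
      1 < dist (circlePt (θ j)) (circlePt (θ l)) := by
  have : NeZero n := ⟨hn0⟩
  obtain ⟨hmono, hlast, hadj, harc, -⟩ := hp
  have hpi := Real.pi_pos
  have hnpos : 0 < n := by omega
  let I : ℕ → Fin n := fun j => ⟨j % n, Nat.mod_lt _ hnpos⟩
  have hI1 : ∀ j, I (j + 1) = I j + 1 := by
    intro j
    apply Fin.ext
    simp [I, Fin.val_add]
  have hIs : ∀ j, I (j + 1) - 1 = I j := by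
    intro j
    rw [hI1, add_sub_cancel_right]
  let T : ℕ → ℝ := fun j => θ (I j) + 2 * Real.pi * (j / n : ℕ)
  let K : ℕ → Fin 3 := fun j => k (I j)
  have hK1 : ∀ j, K (j + 1) ≠ K j := by
    intro j
    have := hadj (I j)
    rwa [← hI1] at this
  have hK2 : ∀ j, K (j + 2) ≠ K j := by
    intro j
    have := hcyc (I (j + 1))
    rw [← hI1, hIs] at this
    exact this
  have hK3 : ∀ j, K (j + 3) = K j := fun j =>
    aux_fin3 _ _ _ _ (hK1 j) (hK1 (j + 1)) (hK1 (j + 2)) (hK2 j) (hK2 (j + 1))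
  have hK3m : ∀ m j, K (j + 3 * m) = K j := by
    intro m
    induction m with
    | zero => intro j; rfl
    | succ m ih => intro j; rw [show j + 3 * (m + 1) = (j + 3 * m) + 3 by ring, hK3, ih]
  have hTend : ∀ j, T (j + 1) = arcEnd n hn0 θ (I j) + 2 * Real.pi * (j / n : ℕ) := by
    intro j
    have hm := Nat.mod_lt j hnpos
    have hdm := Nat.div_add_mod j n
    by_cases h : j % n + 1 = n
    · have hq : (j + 1) / n = j / n + 1 := by
        rw [Nat.succ_div_of_dvd]
        exact ⟨j / n + 1, by rw [mul_add]; omega⟩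
      have hI0 : I (j + 1) = 0 := by
        apply Fin.ext
        have : (j + 1) % n = 0 := Nat.mod_eq_zero_of_dvd ⟨j / n + 1, by rw [mul_add]; omega⟩
        simpa [I] using this
      simp only [T, arcEnd, hI0, hq]
      rw [if_pos h]
      push_cast
      ring
    · have hq : (j + 1) / n = j / n := by
        rw [Nat.succ_div_of_not_dvd]
        intro hdvd
        have h0 : (j % n + 1) % n = 0 := by
          rw [Nat.mod_add_mod]
          exact Nat.mod_eq_zero_of_dvd hdvd
        rw [Nat.mod_eq_of_lt (by omega)] at h0
        omega
      simp only [T, arcEnd, hq]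
      rw [if_neg h, hI1]
  have hTlt : ∀ j, θ (I j) < arcEnd n hn0 θ (I j) := by
    intro j
    have hm := Nat.mod_lt j hnpos
    simp only [arcEnd]
    split_ifs with h
    · have : I j = ⟨n - 1, Nat.sub_lt (Nat.pos_of_ne_zero hn0) one_pos⟩ := by
        apply Fin.ext
        have : (I j : ℕ) = j % n := rfl
        simp only [this] at h ⊢
        omega
      rw [this]
      exact hlast
    · apply hmono
      rw [Fin.lt_def, ← hI1]
      have h' : j % n + 1 ≠ n := h
      have : (j + 1) % n = j % n + 1 := by
        rw [← Nat.mod_add_mod, Nat.mod_eq_of_lt (by omega)]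
      change j % n < (j + 1) % n
      omega
  have hT : StrictMono T := by
    apply strictMono_nat_of_lt_succ
    intro j
    rw [hTend]
    have := hTlt j
    simp only [T]
    linarith
  have hper : ∀ j, T (j + n) = T j + 6 * (Real.pi / 3) := by
    intro j
    have : I (j + n) = I j := by
      apply Fin.ext
      simp [I]
    simp only [T, this]
    rw [Nat.add_div_right _ hnpos]
    push_cast
    ring
  have hsep : ∀ i j x y, T i < x → x < T (i + 1) → T j < y → y < T (j + 1) →
      y - x = Real.pi / 3 → K i ≠ K j := by
    intro i j x y h1 h2 h3 h4 h5
    rw [hTend] at h2 h4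
    simp only [T] at h1 h3
    refine harc (I i) (I j) (x - 2 * Real.pi * (i / n : ℕ)) (y - 2 * Real.pi * (j / n : ℕ))
      ⟨by linarith, by linarith⟩ ⟨by linarith, by linarith⟩ ?_
    rw [← aux_periodic (x - _) (i / n), ← aux_periodic (y - _) (j / n), sub_add_cancel,
      sub_add_cancel]
    exact aux_dist_one x y h5
  obtain ⟨e, he⟩ : ∃ e, e = n / 9 := ⟨_, rfl⟩
  have hgap : ∀ i, T i + Real.pi / 3 < T (i + 3 * e) := by
    refine aux_core n (3 * e) (Real.pi / 3) T hT hper (by omega) (by omega) ?_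
    intro i
    by_contra hcon
    push Not at hcon
    obtain ⟨h1, h2⟩ := hcon
    have m1 := hT (Nat.lt_succ_self i)
    have m2 := hT (Nat.lt_succ_self (i + 3 * e))
    simp only [Nat.succ_eq_add_one] at m1 m2
    obtain ⟨y, hy1, hy2⟩ := exists_between
      (show max (T i + Real.pi / 3) (T (i + 3 * e)) <
        min (T (i + 1) + Real.pi / 3) (T (i + 3 * e + 1)) from
        max_lt (lt_min (by linarith) h1) (lt_min h2 m2))
    rw [max_lt_iff] at hy1
    rw [lt_min_iff] at hy2
    refine hsep i (i + 3 * e) (y - Real.pi / 3) y (by linarith) (by linarith) hy1.2 hy2.2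
      (by ring) (hK3m e i).symm
  obtain ⟨c, hc⟩ := aux_pair K hK1 hK2 a b hab
  have hpt : ∀ j, circlePt (θ (I j)) = circlePt (T j) := fun j => (aux_periodic _ _).symm
  have g1 := hgap (c + 1)
  have g2 := hgap (c + 1 + 3 * e)
  have g3 := hgap (c + 1 + 3 * e + 3 * e)
  have g4 : T (c + 1 + 3 * e + 3 * e + 3 * e) ≤ T (c + 1 + n) := hT.monotone (by omega)
  have g5 := hper (c + 1)
  have d1 : 1 < dist (circlePt (θ (I (c + 1)))) (circlePt (θ (I (c + 1 + 3 * e)))) := by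
    rw [hpt, hpt]; exact aux_dist_gt _ _ (by linarith) (by linarith)
  have d2 : 1 < dist (circlePt (θ (I (c + 1)))) (circlePt (θ (I (c + 1 + 3 * e + 3 * e)))) := by
    rw [hpt, hpt]; exact aux_dist_gt _ _ (by linarith) (by linarith)
  have d3 : 1 < dist (circlePt (θ (I (c + 1 + 3 * e))))
      (circlePt (θ (I (c + 1 + 3 * e + 3 * e)))) := by
    rw [hpt, hpt]; exact aux_dist_gt _ _ (by linarith) (by linarith)
  have hne : ∀ i j : Fin n, 1 < dist (circlePt (θ i)) (circlePt (θ j)) → i ≠ j := by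
    rintro i j h rfl
    rw [dist_self] at h
    linarith
  have hcol : ∀ m, ({k (I (c + 1 + 3 * m) - 1), k (I (c + 1 + 3 * m))} : Set (Fin 3)) = {a, b} := by
    intro m
    rw [show c + 1 + 3 * m = c + 3 * m + 1 by ring, hIs]
    have e1 := hK3m m c
    have e2 := hK3m m (c + 1)
    rw [show c + 1 + 3 * m = c + 3 * m + 1 by ring] at e2
    simp only [K] at e1 e2 hc
    rw [e1, e2, hc]
  have hcol2 := hcol (e + e)
  rw [show c + 1 + 3 * (e + e) = c + 1 + 3 * e + 3 * e by ring] at hcol2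
  exact ⟨I (c + 1), I (c + 1 + 3 * e), I (c + 1 + 3 * e + 3 * e), hne _ _ d1, hne _ _ d2,
    hne _ _ d3, hcol 0, hcol e, hcol2, d1, d2, d3⟩
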